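/- Suppose a finite-dimensional Hopf algebra H over a field of characteristic 0 is isomorphic as a Hopf algebra to an iterated double cross product of Hopf algebras A_1, ..., A_n with S_H^2 corresponding to S_{A_1}^2 ⊗ ... ⊗ S_{A_n}^2. Then H is semisimple if and only if every A_i is semisimple. -/

import Mathlib

open TensorProduct

open Coalgebra HopfAlgebra

section Integral

variable {k H : Type*} [Field k] [Ring H] [HopfAlgebra k H]

variable (k H) in
/-- The map `x ↦ x₁ ⊗ S(x₂)`. -/
noncomputable def comulAntipode : H →ₗ[k] H ⊗[k] H :=
  (antipode k).lTensor H ∘ₗ comul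

lemma comulAntipode_mul_left (h x : H) {ι : Type*} (r : Repr k h ι) :
    ∑ i ∈ r.index, comulAntipode k H (r.left i * x) * (1 ⊗ₜ[k] r.right i) =
      (h ⊗ₜ[k] 1) * comulAntipode k H x := by
  have key (X : H ⊗[k] H) : ∑ i ∈ r.index,
      (antipode k).lTensor H (comul (R := k) (r.left i) * X) * (1 ⊗ₜ[k] r.right i) =
      (h ⊗ₜ[k] 1) * (antipode k).lTensor H X := by
    induction X with
    | zero => simp
    | add x y hx hy => simp only [mul_add, add_mul, map_add, Finset.sum_add_distrib, hx, hy]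
    | tmul u v =>
      have h1 := sum_tmul_tmul_eq r (fun i => ℛ k (r.left i)) (fun i => ℛ k (r.right i))
      let F : H ⊗[k] (H ⊗[k] H) →ₗ[k] H ⊗[k] H :=
        TensorProduct.map (LinearMap.mulRight k u)
          (LinearMap.mulLeft k (antipode k v) ∘ₗ LinearMap.mul' k H ∘ₗ (antipode k).rTensor H)
      have h2 := congrArg F h1
      simp only [map_sum, F, TensorProduct.map_tmul, LinearMap.mulRight_apply,
        LinearMap.comp_apply, LinearMap.rTensor_tmul, LinearMap.mul'_apply,
        LinearMap.mulLeft_apply] at h2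
      have h3 (i : ι) : ∑ j ∈ (ℛ k (r.right i)).index, (r.left i * u) ⊗ₜ[k] (antipode k v *
          (antipode k ((ℛ k (r.right i)).left j) * (ℛ k (r.right i)).right j)) =
          (r.left i * u) ⊗ₜ[k] (counit (R := k) (r.right i) • antipode k v) := by
        rw [← TensorProduct.tmul_sum, ← Finset.mul_sum, sum_antipode_mul_eq_smul, mul_smul_comm,
          mul_one]
      rw [Finset.sum_congr rfl fun i _ => h3 i] at h2
      have h4 : ∑ i ∈ r.index, (r.left i * u) ⊗ₜ[k] (counit (R := k) (r.right i) • antipode k v) =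
          (h * u) ⊗ₜ[k] antipode k v := by
        have := congrArg (TensorProduct.map (LinearMap.mulRight k u)
          (LinearMap.toSpanSingleton k H (antipode k v))) (sum_tmul_counit_eq r)
        simpa [-sum_tmul_counit_eq] using this
      rw [h4] at h2
      simp only [LinearMap.lTensor_tmul, Algebra.TensorProduct.tmul_mul_tmul, one_mul]
      rw [← h2]
      refine Finset.sum_congr rfl fun i _ => ?_
      rw [← (ℛ k (r.left i)).eq]
      simp [Finset.sum_mul, antipode_mul_antidistrib, mul_assoc]
  simpa [comulAntipode] using key (comul x)

lemma comulAntipode_mul_right (h x : H) {ι : Type*} (r : Repr k h ι) :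
    ∑ i ∈ r.index, (1 ⊗ₜ[k] antipode k (antipode k (r.right i))) *
        comulAntipode k H (x * r.left i) =
      comulAntipode k H x * (h ⊗ₜ[k] 1) := by
  have key (X : H ⊗[k] H) : ∑ i ∈ r.index,
      (1 ⊗ₜ[k] antipode k (antipode k (r.right i))) *
        (antipode k).lTensor H (X * comul (R := k) (r.left i)) =
      (antipode k).lTensor H X * (h ⊗ₜ[k] 1) := by
    induction X with
    | zero => simp
    | add x y hx hy => simp only [mul_add, add_mul, map_add, Finset.sum_add_distrib, hx, hy]
    | tmul u v =>
      have h1 := sum_tmul_tmul_eq r (fun i => ℛ k (r.left i)) (fun i => ℛ k (r.right i))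
      let F : H ⊗[k] (H ⊗[k] H) →ₗ[k] H ⊗[k] H :=
        TensorProduct.map (LinearMap.mulLeft k u)
          (antipode k ∘ₗ LinearMap.mulLeft k v ∘ₗ LinearMap.mul' k H ∘ₗ (antipode k).lTensor H)
      have h2 := congrArg F h1
      simp only [map_sum, F, TensorProduct.map_tmul, LinearMap.mulLeft_apply,
        LinearMap.comp_apply, LinearMap.lTensor_tmul, LinearMap.mul'_apply] at h2
      have h3 (i : ι) : ∑ j ∈ (ℛ k (r.right i)).index, (u * r.left i) ⊗ₜ[k] (antipode k (v *
          ((ℛ k (r.right i)).left j * antipode k ((ℛ k (r.right i)).right j)))) =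
          (u * r.left i) ⊗ₜ[k] (counit (R := k) (r.right i) • antipode k v) := by
        rw [← TensorProduct.tmul_sum, ← map_sum, ← Finset.mul_sum, sum_mul_antipode_eq_smul,
          mul_smul_comm, mul_one, map_smul]
      rw [Finset.sum_congr rfl fun i _ => h3 i] at h2
      have h4 : ∑ i ∈ r.index, (u * r.left i) ⊗ₜ[k] (counit (R := k) (r.right i) • antipode k v) =
          (u * h) ⊗ₜ[k] antipode k v := by
        have := congrArg (TensorProduct.map (LinearMap.mulLeft k u)
          (LinearMap.toSpanSingleton k H (antipode k v))) (sum_tmul_counit_eq r)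
        simpa [-sum_tmul_counit_eq] using this
      rw [h4] at h2
      simp only [LinearMap.lTensor_tmul, Algebra.TensorProduct.tmul_mul_tmul, mul_one]
      rw [← h2]
      refine Finset.sum_congr rfl fun i _ => ?_
      rw [← (ℛ k (r.left i)).eq]
      simp [Finset.mul_sum, antipode_mul_antidistrib, mul_assoc]
  simpa [comulAntipode] using key (comul x)

/-- `Λ` is a left integral of `H`. -/
def IsLeftIntegral (k : Type*) {H : Type*} [Field k] [Ring H] [HopfAlgebra k H] (Λ : H) : Prop :=
  ∀ a : H, a * Λ = counit (R := k) a • Λ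

/-- `Λ` is a right integral of `H`. -/
def IsRightIntegral (k : Type*) {H : Type*} [Field k] [Ring H] [HopfAlgebra k H] (Λ : H) : Prop :=
  ∀ a : H, Λ * a = counit (R := k) a • Λ

lemma IsLeftIntegral.tmul_one_mul_comulAntipode {Λ : H} (hΛ : IsLeftIntegral k Λ) (a : H) :
    (a ⊗ₜ[k] 1) * comulAntipode k H Λ = comulAntipode k H Λ * (1 ⊗ₜ[k] a) := by
  rw [← comulAntipode_mul_left a Λ (ℛ k a)]
  conv_rhs => rw [← sum_counit_smul (ℛ k a)]
  simp [hΛ _, Finset.mul_sum, TensorProduct.tmul_sum]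

lemma IsRightIntegral.comulAntipode_mul_tmul_one {Λ : H} (hΛ : IsRightIntegral k Λ) (a : H) :
    comulAntipode k H Λ * (a ⊗ₜ[k] 1) =
      (1 ⊗ₜ[k] antipode k (antipode k a)) * comulAntipode k H Λ := by
  rw [← comulAntipode_mul_right a Λ (ℛ k a)]
  conv_rhs => rw [← sum_counit_smul (ℛ k a)]
  simp [hΛ _, Finset.sum_mul, TensorProduct.tmul_sum]

lemma mul'_comulAntipode (x : H) :
    LinearMap.mul' k H (comulAntipode k H x) = algebraMap k H (counit x) := by
  simp [comulAntipode]

lemma isSemisimpleRing_of_isLeftIntegral {Λ : H} (hΛ : IsLeftIntegral k Λ)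
    (h1 : counit (R := k) Λ = 1) : IsSemisimpleRing H := by
  obtain ⟨s, hs⟩ := TensorProduct.exists_finset (comulAntipode k H Λ)
  have hmul : ∑ i ∈ s, i.1 * i.2 = 1 := by
    have := mul'_comulAntipode (k := k) Λ
    simpa [hs, h1] using this
  refine (isSemisimpleModule_iff H H).2 ⟨fun N => ?_⟩
  obtain ⟨p, hp⟩ := (N.restrictScalars k).subtype.exists_leftInverse_of_injective (by simp)
  let q : H →ₗ[k] H := ∑ i ∈ s, LinearMap.mulLeft k i.1 ∘ₗ (N.restrictScalars k).subtype ∘ₗ p ∘ₗ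
    LinearMap.mulLeft k i.2
  have hq (x : H) : q x = ∑ i ∈ s, i.1 * (p (i.2 * x) : H) := by simp [q]
  have hqN (x : H) : q x ∈ N := by
    rw [hq]
    exact sum_mem fun i _ => N.smul_mem _ (p (i.2 * x)).2
  have hpn (n : H) (hn : n ∈ N) : (p n : H) = n := by
    have := LinearMap.congr_fun hp ⟨n, hn⟩
    exact congrArg Subtype.val this
  have hqn (n : H) (hn : n ∈ N) : q n = n := by
    have h2 (i : H × H) : i.1 * (p (i.2 * n) : H) = i.1 * i.2 * n := by
      rw [hpn (i.2 * n) (N.smul_mem i.2 hn), ← mul_assoc]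
    rw [hq, Finset.sum_congr rfl fun i _ => h2 i, ← Finset.sum_mul, hmul, one_mul]
  have hqlin (a x : H) : q (a * x) = a * q x := by
    have h2 := hΛ.tmul_one_mul_comulAntipode a
    rw [hs] at h2
    have h3 := congrArg (LinearMap.mul' k H ∘ₗ TensorProduct.map LinearMap.id
      ((N.restrictScalars k).subtype ∘ₗ p ∘ₗ LinearMap.mulRight k x)) h2
    simp only [Finset.mul_sum, Finset.sum_mul, map_sum] at h3
    simp only [Algebra.TensorProduct.tmul_mul_tmul, mul_one, one_mul, LinearMap.comp_apply,
      TensorProduct.map_tmul, LinearMap.mul'_apply, LinearMap.mulRight_apply, LinearMap.id_apply,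
      Submodule.subtype_apply] at h3
    rw [hq, hq, Finset.mul_sum]
    simp only [mul_assoc] at h3 ⊢
    exact h3.symm
  let Q : H →ₗ[H] N :=
    { toFun := fun x => ⟨q x, hqN x⟩
      map_add' := fun x y => by ext; simp
      map_smul' := fun a x => by ext; simp [hqlin] }
  exact ⟨LinearMap.ker Q, LinearMap.isCompl_of_proj (f := Q) fun x => by ext; simp [Q, hqn]⟩

lemma exists_isLeftIntegral [IsSemisimpleRing H] :
    ∃ Λ : H, IsLeftIntegral k Λ ∧ counit (R := k) Λ = 1 := by
  obtain ⟨J, hJ⟩ := exists_isCompl (RingHom.ker (Bialgebra.counitAlgHom k H) : Ideal H)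
  have h1 : (1 : H) ∈ (RingHom.ker (Bialgebra.counitAlgHom k H) : Ideal H) ⊔ J := by
    rw [hJ.sup_eq_top]; trivial
  obtain ⟨x, hx, Λ, hΛ, h⟩ := Submodule.mem_sup.1 h1
  have hx' : counit (R := k) x = 0 := by simpa using hx
  have hc : counit (R := k) Λ = 1 := by
    have := congrArg (counit (R := k)) h
    simpa [hx'] using this
  refine ⟨Λ, fun a => ?_, hc⟩
  have h0 : a * Λ - counit (R := k) a • Λ ∈
      (RingHom.ker (Bialgebra.counitAlgHom k H) : Ideal H) ⊓ J := by
    refine ⟨by simp [RingHom.mem_ker, hc], J.sub_mem (J.mul_mem_left _ hΛ) ?_⟩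
    rw [Algebra.smul_def]
    exact J.mul_mem_left _ hΛ
  rw [hJ.inf_eq_bot] at h0
  exact sub_eq_zero.1 h0

lemma exists_isRightIntegral [IsSemisimpleRing H] :
    ∃ Λ : H, IsRightIntegral k Λ ∧ counit (R := k) Λ = 1 := by
  let φ : Hᵐᵒᵖ →ₐ[k] k :=
    AlgHom.ofLinearMap ((Bialgebra.counitAlgHom k H).toLinearMap ∘ₗ
      (MulOpposite.opLinearEquiv k).symm.toLinearMap) (by simp) (by simp [mul_comm])
  have hφ (x : Hᵐᵒᵖ) : φ x = counit (R := k) x.unop := rfl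
  obtain ⟨J, hJ⟩ := exists_isCompl (RingHom.ker φ : Ideal Hᵐᵒᵖ)
  have h1 : (1 : Hᵐᵒᵖ) ∈ (RingHom.ker φ : Ideal Hᵐᵒᵖ) ⊔ J := by
    rw [hJ.sup_eq_top]; trivial
  obtain ⟨x, hx, Λ, hΛ, h⟩ := Submodule.mem_sup.1 h1
  have hx' : φ x = 0 := hx
  have hc : φ Λ = 1 := by
    have := congrArg φ h
    simpa [hx'] using this
  refine ⟨Λ.unop, fun a => ?_, hc⟩
  have h0 : MulOpposite.op a * Λ - φ (MulOpposite.op a) • Λ ∈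
      (RingHom.ker φ : Ideal Hᵐᵒᵖ) ⊓ J := by
    refine ⟨by simp [RingHom.mem_ker, hc], J.sub_mem (J.mul_mem_left _ hΛ) ?_⟩
    rw [Algebra.smul_def]
    exact J.mul_mem_left _ hΛ
  rw [hJ.inf_eq_bot] at h0
  have := congrArg MulOpposite.unop (sub_eq_zero.1 h0)
  simpa [hφ] using this

lemma exists_integral [IsSemisimpleRing H] :
    ∃ Λ : H, IsLeftIntegral k Λ ∧ IsRightIntegral k Λ ∧ counit (R := k) Λ = 1 := by
  obtain ⟨Λ, hΛ, h1⟩ := exists_isLeftIntegral (k := k) (H := H)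
  obtain ⟨Λ', hΛ', h1'⟩ := exists_isRightIntegral (k := k) (H := H)
  have : Λ = Λ' := by
    have h2 := hΛ Λ'
    rw [hΛ' Λ, h1, h1', one_smul, one_smul] at h2
    exact h2.symm
  exact ⟨Λ, hΛ, this ▸ hΛ', h1⟩

/-- The square of the antipode. -/
noncomputable abbrev antipodeSq (k H : Type*) [Field k] [Ring H] [HopfAlgebra k H] : H →ₗ[k] H :=
  antipode k ∘ₗ antipode k

lemma isSemisimpleRing_of_trace_ne_zero [FiniteDimensional k H]
    (h : LinearMap.trace k H (antipodeSq k H) ≠ 0) : IsSemisimpleRing H := by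
  let D (p : Module.Dual k H) : H →ₗ[k] H :=
    (TensorProduct.lid k H).toLinearMap ∘ₗ TensorProduct.map p (antipode k) ∘ₗ comulAntipode k H
  let D' : Module.Dual k H →ₗ[k] (H →ₗ[k] H) :=
    { toFun := D
      map_add' := fun p q => by ext; simp [D, TensorProduct.map_add_left]
      map_smul' := fun c p => by ext; simp [D, TensorProduct.map_smul_left] }
  let Λ : H := (Module.evalEquiv k H).symm (LinearMap.trace k H ∘ₗ D')
  have hΛ (p : Module.Dual k H) : p Λ = LinearMap.trace k H (D p) := by
    have := Module.apply_evalEquiv_symm_apply k H p (LinearMap.trace k H ∘ₗ D')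
    exact this
  have hD (p : Module.Dual k H) (a : H) : D (p ∘ₗ LinearMap.mulLeft k a) =
      ∑ i ∈ (ℛ k a).index, LinearMap.mulLeft k (antipode k ((ℛ k a).right i)) * (D p *
        LinearMap.mulLeft k ((ℛ k a).left i)) := by
    ext x
    have h2 := congrArg ((TensorProduct.lid k H).toLinearMap ∘ₗ TensorProduct.map p (antipode k))
      (comulAntipode_mul_left a x (ℛ k a))
    have h3 (X : H ⊗[k] H) : TensorProduct.map p (antipode k) ((a ⊗ₜ[k] 1) * X) =
        TensorProduct.map (p ∘ₗ LinearMap.mulLeft k a) (antipode k) X := by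
      induction X with
      | zero => simp
      | tmul => simp
      | add x y hx hy => simp only [mul_add, map_add, hx, hy]
    have h4 (X : H ⊗[k] H) (b : H) : TensorProduct.lid k H
        (TensorProduct.map p (antipode k) (X * (1 ⊗ₜ[k] b))) =
        antipode k b * TensorProduct.lid k H (TensorProduct.map p (antipode k) X) := by
      induction X with
      | zero => simp
      | tmul => simp [antipode_mul_antidistrib]
      | add x y hx hy => simp only [add_mul, mul_add, map_add, hx, hy]
    simp only [map_sum, LinearMap.comp_apply, h3, h4, LinearEquiv.coe_coe] at h2
    simpa [D] using h2.symm
  have hint : IsLeftIntegral k Λ := by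
    intro a
    rw [← sub_eq_zero, ← Module.forall_dual_apply_eq_zero_iff k]
    intro p
    have h2 := hΛ (p ∘ₗ LinearMap.mulLeft k a)
    rw [hD, map_sum] at h2
    have h3 : ∑ i ∈ (ℛ k a).index, LinearMap.trace k H
        (LinearMap.mulLeft k (antipode k ((ℛ k a).right i)) * (D p *
        LinearMap.mulLeft k ((ℛ k a).left i))) = counit (R := k) a • p Λ := by
      have h4 (i) : LinearMap.trace k H
        (LinearMap.mulLeft k (antipode k ((ℛ k a).right i)) * (D p *
        LinearMap.mulLeft k ((ℛ k a).left i))) = LinearMap.trace k H (D p *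
          LinearMap.mulLeft k ((ℛ k a).left i * antipode k ((ℛ k a).right i))) := by
        rw [LinearMap.trace_mul_comm, mul_assoc, LinearMap.mulLeft_mul]
        rfl
      have h5 : ∑ i ∈ (ℛ k a).index, LinearMap.mulLeft k
          ((ℛ k a).left i * antipode k ((ℛ k a).right i)) =
          counit (R := k) a • (1 : H →ₗ[k] H) := by
        ext x
        have := congrArg (· * x) (sum_mul_antipode_eq_smul (ℛ k a))
        simpa [Finset.sum_mul, mul_assoc] using this
      rw [Finset.sum_congr rfl fun i _ => h4 i, ← map_sum, ← Finset.mul_sum, h5, hΛ]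
      simp
    rw [h3] at h2
    simp only [LinearMap.comp_apply, LinearMap.mulLeft_apply] at h2
    simp [h2]
  have hcounit : counit (R := k) Λ = LinearMap.trace k H (antipodeSq k H) := by
    rw [hΛ]
    congr 1
    ext x
    have : D counit x = antipode k (antipode k x) := by
      have h2 := congrArg ((TensorProduct.lid k H).toLinearMap ∘ₗ (antipodeSq k H).lTensor k)
        (rTensor_counit_comul x (R := k))
      simp only [LinearMap.comp_apply, LinearMap.lTensor_tmul, LinearEquiv.coe_coe,
        TensorProduct.lid_tmul, one_smul] at h2
      rw [← h2]
      simp only [D, comulAntipode, LinearMap.comp_apply, LinearEquiv.coe_coe]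
      congr 1
      induction comul (R := k) x with
      | zero => simp
      | tmul => simp
      | add x y hx hy => simp only [map_add, hx, hy]
    exact this
  refine isSemisimpleRing_of_isLeftIntegral (k := k)
    (Λ := (LinearMap.trace k H (antipodeSq k H))⁻¹ • Λ) (fun a => ?_) ?_
  · rw [mul_smul_comm, hint a, smul_comm]
  · rw [map_smul, hcounit, smul_eq_mul, inv_mul_cancel₀ h]

end Integral

section SymmetricForm

variable {k A : Type*} [Field k] [Ring A] [Algebra k A]

/-- The sum of the characters of the left and right regular representations. -/
noncomputable def regularForm (k A : Type*) [Field k] [Ring A] [Algebra k A] : A →ₗ[k] k :=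
  LinearMap.trace k A ∘ₗ LinearMap.mul k A + LinearMap.trace k A ∘ₗ (LinearMap.mul k A).flip

lemma regularForm_apply (a : A) : regularForm k A a =
    LinearMap.trace k A (LinearMap.mulLeft k a) + LinearMap.trace k A (LinearMap.mulRight k a) :=
  rfl

lemma regularForm_mul_comm (a b : A) : regularForm k A (a * b) = regularForm k A (b * a) := by
  simp only [regularForm_apply, LinearMap.mulLeft_mul, LinearMap.mulRight_mul]
  exact congrArg₂ (· + ·) (LinearMap.trace_mul_comm k _ _) (LinearMap.trace_mul_comm k _ _)

lemma eq_zero_of_regularForm_mul_eq_zero [CharZero k] [FiniteDimensional k A] [IsSemisimpleRing A]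
    {a : A} (h : ∀ b, regularForm k A (b * a) = 0) : a = 0 := by
  obtain ⟨e, he, hspan⟩ := IsSemisimpleRing.ideal_eq_span_idempotent (Ideal.span {a})
  obtain ⟨b, hb⟩ := Ideal.mem_span_singleton'.1
    (hspan ▸ Ideal.mem_span_singleton_self e : e ∈ Ideal.span {a})
  obtain ⟨c, hc⟩ := Ideal.mem_span_singleton'.1
    (hspan ▸ Ideal.mem_span_singleton_self a : a ∈ Ideal.span {e})
  have hl : IsIdempotentElem (LinearMap.mulLeft k e) := by
    ext x; simp [← mul_assoc, he.eq]
  have hr : IsIdempotentElem (LinearMap.mulRight k e) := by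
    ext x; simp [mul_assoc, he.eq]
  have ht := h b
  rw [hb, regularForm_apply, (LinearMap.IsIdempotentElem.isProj_range _ hl).trace,
    (LinearMap.IsIdempotentElem.isProj_range _ hr).trace] at ht
  norm_cast at ht
  have h0 : LinearMap.range (LinearMap.mulLeft k e) = ⊥ := by
    rw [← Submodule.finrank_eq_zero (R := k)]; omega
  have he0 : e = 0 := by
    have := LinearMap.range_eq_bot.1 h0
    simpa using LinearMap.congr_fun this 1
  rw [← hc, he0, mul_zero]

end SymmetricForm

section Radford

variable {k H : Type*} [Field k] [Ring H] [HopfAlgebra k H]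

/-- `x ↦ f(x₁) x₂`. -/
noncomputable def contractLeftComul (f : Module.Dual k H) : H →ₗ[k] H :=
  (TensorProduct.lid k H).toLinearMap ∘ₗ f.rTensor H ∘ₗ comul

/-- `x ↦ f(x₂) x₁`. -/
noncomputable def contractRightComul (f : Module.Dual k H) : H →ₗ[k] H :=
  (TensorProduct.rid k H).toLinearMap ∘ₗ f.lTensor H ∘ₗ comul

lemma contractLeftComul_apply (f : Module.Dual k H) {x : H} {ι : Type*} (r : Repr k x ι) :
    contractLeftComul f x = ∑ i ∈ r.index, f (r.left i) • r.right i := by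
  simp [contractLeftComul, ← r.eq]

lemma contractRightComul_apply (f : Module.Dual k H) {x : H} {ι : Type*} (r : Repr k x ι) :
    contractRightComul f x = ∑ i ∈ r.index, f (r.right i) • r.left i := by
  simp [contractRightComul, ← r.eq]

lemma apply_contractRightComul (f g : Module.Dual k H) (x : H) :
    f (contractRightComul g x) = g (contractLeftComul f x) := by
  simp [contractLeftComul_apply _ (ℛ k x), contractRightComul_apply _ (ℛ k x), mul_comm]

lemma contractLeftComul_contractRightComul (f g : Module.Dual k H) (x : H) :
    contractLeftComul f (contractRightComul g x) =
      contractRightComul g (contractLeftComul f x) := by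
  have h1 := sum_tmul_tmul_eq (ℛ k x) (fun i => ℛ k ((ℛ k x).left i))
    (fun i => ℛ k ((ℛ k x).right i))
  have h2 := congrArg ((TensorProduct.lid k H).toLinearMap ∘ₗ TensorProduct.map f
    ((TensorProduct.rid k H).toLinearMap ∘ₗ g.lTensor H)) h1
  rw [contractLeftComul_apply f (ℛ k x), contractRightComul_apply g (ℛ k x)]
  simp only [map_sum, map_smul, contractLeftComul_apply f (ℛ k ((ℛ k x).left _)),
    contractRightComul_apply g (ℛ k ((ℛ k x).right _)), Finset.smul_sum]
  simp only [map_sum, LinearMap.comp_apply, TensorProduct.map_tmul, LinearMap.lTensor_tmul,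
    LinearEquiv.coe_coe, TensorProduct.rid_tmul, TensorProduct.lid_tmul] at h2
  rw [← h2]
  exact Finset.sum_congr rfl fun i _ => Finset.sum_congr rfl fun j _ => smul_comm _ _ _

lemma contractLeftComul_contractLeftComul (f g : Module.Dual k H) (x : H) :
    contractLeftComul f (contractLeftComul g x) =
      contractLeftComul (f ∘ₗ contractLeftComul g) x := by
  have h1 := sum_tmul_tmul_eq (ℛ k x) (fun i => ℛ k ((ℛ k x).left i))
    (fun i => ℛ k ((ℛ k x).right i))
  have h2 := congrArg ((TensorProduct.lid k H).toLinearMap ∘ₗ TensorProduct.map g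
    ((TensorProduct.lid k H).toLinearMap ∘ₗ f.rTensor H)) h1
  rw [contractLeftComul_apply g (ℛ k x), contractLeftComul_apply _ (ℛ k x)]
  simp only [map_sum, map_smul, contractLeftComul_apply f (ℛ k ((ℛ k x).right _)),
    LinearMap.comp_apply, Finset.sum_smul,
    contractLeftComul_apply g (ℛ k ((ℛ k x).left _)), Finset.smul_sum]
  simp only [map_sum, LinearMap.comp_apply, TensorProduct.map_tmul, LinearMap.rTensor_tmul,
    LinearEquiv.coe_coe, TensorProduct.lid_tmul] at h2
  rw [← h2]
  exact Finset.sum_congr rfl fun i _ => Finset.sum_congr rfl fun j _ => by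
    rw [smul_smul, smul_eq_mul]

lemma comul_contractRightComul (f : Module.Dual k H) (x : H) :
    comul (R := k) (contractRightComul f x) =
      (contractRightComul f).lTensor H (comul (R := k) x) := by
  have h1 := sum_tmul_tmul_eq (ℛ k x) (fun i => ℛ k ((ℛ k x).left i))
    (fun i => ℛ k ((ℛ k x).right i))
  have h2 := congrArg (((TensorProduct.rid k H).toLinearMap ∘ₗ f.lTensor H).lTensor H) h1
  rw [contractRightComul_apply f (ℛ k x), ← (ℛ k x).eq]
  simp only [map_sum, map_smul, LinearMap.lTensor_tmul,
    contractRightComul_apply f (ℛ k ((ℛ k x).right _)), TensorProduct.tmul_sum,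
    ← (ℛ k ((ℛ k x).left _)).eq, Finset.smul_sum]
  simp only [map_sum, LinearMap.comp_apply, LinearMap.lTensor_tmul,
    LinearEquiv.coe_coe, TensorProduct.rid_tmul] at h2
  rw [← h2]
  simp only [TensorProduct.tmul_smul]

lemma contractRightComul_one (f : Module.Dual k H) : contractRightComul f 1 = f 1 • 1 := by
  simp [contractRightComul, Algebra.TensorProduct.one_def]

lemma contractLeftComul_counit (x : H) : contractLeftComul (counit (R := k)) x = x := by
  simp [contractLeftComul]

lemma IsGroupLikeElem.exists_pow_eq_one [FiniteDimensional k H] {g h : H}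
    (hg : IsGroupLikeElem k g) (hgh : h * g = 1) : ∃ m, 0 < m ∧ g ^ m = 1 := by
  have hfin : Finite (GroupLike k H) := (linearIndep_groupLikeVal (R := k) (A := H)).finite
  obtain ⟨a, b, hab, h1⟩ := Finite.exists_ne_map_eq_of_infinite
    (fun n : ℕ => (⟨g, hg⟩ : GroupLike k H) ^ n)
  have h2 : g ^ a = g ^ b := by simpa using congrArg GroupLike.val h1
  have hcancel (n : ℕ) : h ^ n * g ^ n = 1 := by
    induction n with
    | zero => simp
    | succ n ih =>
      rw [pow_succ, pow_succ', mul_assoc, ← mul_assoc h, hgh, one_mul, ih]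
  have key (a b : ℕ) (hab : a < b) (h2 : g ^ a = g ^ b) : ∃ m, 0 < m ∧ g ^ m = 1 := by
    refine ⟨b - a, by omega, ?_⟩
    have h3 := congrArg (h ^ a * ·) h2
    simp only [hcancel] at h3
    rw [← Nat.add_sub_cancel' hab.le, pow_add, ← mul_assoc, hcancel, one_mul] at h3
    exact h3.symm
  rcases lt_or_gt_of_ne hab with hlt | hlt
  · exact key a b hlt h2
  · exact key b a hlt h2.symm

lemma regularForm_antipode (hS : Function.Bijective (antipode k : H →ₗ[k] H)) (a : H) :
    regularForm k H (antipode k a) = regularForm k H a := by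
  let e : H ≃ₗ[k] H := LinearEquiv.ofBijective (antipode k) hS
  have h1 : LinearMap.mulLeft k (antipode k a) = e.conj (LinearMap.mulRight k a) := by
    ext x
    obtain ⟨y, rfl⟩ := e.surjective x
    simp [LinearEquiv.conj_apply, e, antipode_mul_antidistrib]
  have h2 : LinearMap.mulRight k (antipode k a) = e.conj (LinearMap.mulLeft k a) := by
    ext x
    obtain ⟨y, rfl⟩ := e.surjective x
    simp [LinearEquiv.conj_apply, e, antipode_mul_antidistrib]
  rw [regularForm_apply, regularForm_apply, h1, h2, LinearMap.trace_conj', LinearMap.trace_conj',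
    add_comm]

variable [CharZero k] [FiniteDimensional k H] [IsSemisimpleRing H]

/-- In a finite-dimensional semisimple Hopf algebra the square of the antipode is conjugation by
a unit some power of which is central. -/
theorem exists_antipode_antipode_eq_conj : ∃ z w : H, z * w = 1 ∧ w * z = 1 ∧
    (∀ a, antipode k (antipode k a) = z * a * w) ∧ ∃ N, 0 < N ∧ ∀ a, Commute (z ^ N) a := by
  obtain ⟨Λ, hl, hr, h1⟩ := exists_integral (k := k) (H := H)
  let r := ℛ k Λ
  let S : H →ₗ[k] H := antipode k
  have hSmul (a b : H) : S (a * b) = S b * S a := antipode_mul_antidistrib a b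
  have hS1 : S 1 = 1 := antipode_one
  let t := regularForm k H
  have tcomm (a b : H) : t (a * b) = t (b * a) := regularForm_mul_comm a b
  have tnd {a : H} (h : ∀ b, t (b * a) = 0) : a = 0 := eq_zero_of_regularForm_mul_eq_zero h
  have he : comulAntipode k H Λ = ∑ i ∈ r.index, r.left i ⊗ₜ[k] S (r.right i) := by
    simp [comulAntipode, ← r.eq, S]
  obtain ⟨z, hz⟩ : ∃ z, z = ∑ i ∈ r.index, t (r.left i) • S (r.right i) := ⟨_, rfl⟩
  have hzl (a : H) : ∑ i ∈ r.index, t (a * r.left i) • S (r.right i) = z * a := by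
    have := congrArg ((TensorProduct.lid k H).toLinearMap ∘ₗ t.rTensor H)
      (hl.tmul_one_mul_comulAntipode a)
    simpa [he, Finset.mul_sum, Finset.sum_mul, hz] using this
  have hzr (a : H) : ∑ i ∈ r.index, t (r.left i * a) • S (r.right i) = S (S a) * z := by
    have := congrArg ((TensorProduct.lid k H).toLinearMap ∘ₗ t.rTensor H)
      (hr.comulAntipode_mul_tmul_one a)
    simpa [he, Finset.mul_sum, Finset.sum_mul, hz] using this
  have hconj (a : H) : S (S a) * z = z * a := by
    rw [← hzl, ← hzr]
    simp only [tcomm a]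
  have hsep : ∑ i ∈ r.index, r.left i * S (r.right i) = 1 := by
    have := mul'_comulAntipode (k := k) Λ
    simpa [he, h1] using this
  have hzinj (a : H) (ha : z * a = 0) : a = 0 := by
    have tsurj : Function.Surjective ((LinearMap.mul k H).compr₂ t) := by
      refine (LinearMap.injective_iff_surjective_of_finrank_eq_finrank
        Subspace.dual_finrank_eq.symm).1 ?_
      rw [injective_iff_map_eq_zero]
      intro b hb
      refine tnd fun c => ?_
      rw [tcomm]
      exact LinearMap.congr_fun hb c
    have hp (p : Module.Dual k H) :
        ∑ i ∈ r.index, p (r.left i) • (S (r.right i) * a) = 0 := by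
      obtain ⟨b, rfl⟩ := tsurj p
      have := congrArg (· * a) (hzl b)
      simp only [Finset.sum_mul, smul_mul_assoc] at this
      simp only [LinearMap.compr₂_apply, LinearMap.mul_apply', this]
      rw [← hconj, mul_assoc, ha, mul_zero]
    let b := Module.finBasis k H
    calc a = ∑ i ∈ r.index, r.left i * (S (r.right i) * a) := by
          simp only [← mul_assoc, ← Finset.sum_mul, hsep, one_mul]
      _ = ∑ i ∈ r.index, ∑ j, b j * (b.coord j (r.left i) • (S (r.right i) * a)) := by
          refine Finset.sum_congr rfl fun i _ => ?_
          have := congrArg (· * (S (r.right i) * a)) (b.sum_repr (r.left i)).symm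
          simpa [-Module.Basis.sum_repr, Finset.sum_mul] using this
      _ = 0 := by
          rw [Finset.sum_comm]
          simp only [← Finset.mul_sum, hp, mul_zero, Finset.sum_const_zero]
  obtain ⟨w, hzw⟩ : ∃ w, z * w = 1 := by
    have hi : Function.Injective (LinearMap.mulLeft k z) :=
      (injective_iff_map_eq_zero _).2 hzinj
    exact LinearMap.surjective_of_injective hi 1
  have hwz : w * z = 1 := by
    refine sub_eq_zero.1 (hzinj _ ?_)
    rw [mul_sub, ← mul_assoc, hzw, one_mul, mul_one, sub_self]
  have hSinj : Function.Injective S := by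
    rw [injective_iff_map_eq_zero]
    intro a ha
    apply hzinj
    rw [← hconj, ha, map_zero, zero_mul]
  have hSbij : Function.Bijective S := ⟨hSinj, LinearMap.surjective_of_injective hSinj⟩
  have tS (a : H) : t (S a) = t a := regularForm_antipode hSbij a
  let l : Module.Dual k H := t ∘ₗ LinearMap.mulLeft k w
  have hl_apply (a : H) : l a = t (w * a) := rfl
  have F1 (a : H) : ∑ i ∈ r.index, l (a * r.left i) • S (r.right i) = a := by
    have := hzl (w * a)
    rw [← mul_assoc, hzw, one_mul] at this
    simpa only [hl_apply, ← mul_assoc] using this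
  have F1' : contractLeftComul l Λ = 1 := by
    apply hSinj
    rw [hS1, contractLeftComul_apply l r]
    simpa using F1 1
  have lnd {u : H} (h : ∀ a, l (a * u) = 0) : u = 0 := by
    refine tnd fun b => ?_
    have := h (z * b)
    rwa [hl_apply, ← mul_assoc, ← mul_assoc, hwz, one_mul] at this
  have F2 (b : H) : ∑ i ∈ r.index, l (S (r.right i) * b) • r.left i = b := by
    refine sub_eq_zero.1 (lnd fun a => ?_)
    have := congrArg (fun x => l (x * b)) (F1 a)
    simp only [Finset.sum_mul, smul_mul_assoc, map_sum, map_smul, smul_eq_mul] at this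
    simp only [mul_sub, Finset.mul_sum, mul_smul_comm, map_sub, map_sum, map_smul, smul_eq_mul,
      ← this, mul_comm (l (a * _)), sub_self]
  have hinj (p q : Module.Dual k H) (h : contractLeftComul p Λ = contractLeftComul q Λ) :
      p = q := by
    have (p : Module.Dual k H) (b : H) : p b = l (S (contractLeftComul p Λ) * b) := by
      conv_lhs => rw [← F2 b]
      simp [contractLeftComul_apply p r, Finset.sum_mul, mul_comm]
    ext b
    rw [this p, this q, h]
  have F3 (b : H) : contractLeftComul l b = l b • 1 := by
    let p : Module.Dual k H := l ∘ₗ LinearMap.mulRight k b ∘ₗ S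
    have hb : b = contractRightComul p Λ := by
      conv_lhs => rw [← F2 b]
      simp [contractRightComul_apply p r, p]
    rw [hb, contractLeftComul_contractRightComul, apply_contractRightComul, F1',
      contractRightComul_one]
  obtain ⟨g, hgdef⟩ : ∃ g, g = contractRightComul l Λ := ⟨_, rfl⟩
  have F4 (b : H) : contractRightComul l b = l b • g := by
    rw [← sub_eq_zero, ← Module.forall_dual_apply_eq_zero_iff k]
    intro q
    have hμ : l ∘ₗ contractLeftComul q = l (contractLeftComul q Λ) • l := by
      apply hinj
      rw [← contractLeftComul_contractLeftComul, F3]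
      have : contractLeftComul (l (contractLeftComul q Λ) • l) Λ =
          l (contractLeftComul q Λ) • contractLeftComul l Λ := by
        simp [contractLeftComul_apply _ r, Finset.smul_sum, smul_smul]
      rw [this, F1']
    have := LinearMap.congr_fun hμ b
    simp only [LinearMap.comp_apply, LinearMap.smul_apply, smul_eq_mul] at this
    rw [map_sub, map_smul, hgdef, apply_contractRightComul, apply_contractRightComul, this,
      smul_eq_mul, mul_comm, sub_self]
  have hg : IsGroupLikeElem k g := by
    constructor
    · rw [hgdef, apply_contractRightComul, contractLeftComul_counit]
      have := F3 Λ
      rw [F1'] at this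
      have := congrArg (counit (R := k)) this
      simpa using this.symm
    · rw [hgdef, comul_contractRightComul, ← hgdef, ← r.eq, map_sum]
      simp only [LinearMap.lTensor_tmul, F4, TensorProduct.tmul_smul]
      have hg' : g = ∑ i ∈ r.index, l (r.right i) • r.left i := by
        rw [hgdef, contractRightComul_apply l r]
      have := congrArg (· ⊗ₜ[k] g) hg'
      simp only [TensorProduct.sum_tmul, ← TensorProduct.smul_tmul'] at this
      exact this.symm
  have hgz : g = S w * z := by
    rw [← F2 (S w * z), hgdef, contractRightComul_apply l r]
    refine Finset.sum_congr rfl fun i _ => ?_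
    rw [hl_apply, hl_apply, ← tS (w * r.right i), hSmul, tcomm w, mul_assoc, mul_assoc, hzw,
      mul_one]
  have hSzw : S w * S z = 1 := by rw [← hSmul, hzw, hS1]
  have hSwz : S z * S w = 1 := by rw [← hSmul, hwz, hS1]
  obtain ⟨m, hm, hgm⟩ := hg.exists_pow_eq_one (h := w * S z) (by
    rw [hgz, mul_assoc, ← mul_assoc (S z), hSwz, one_mul, hwz])
  have hc (b : H) : S z * z * b = b * (S z * z) := by
    obtain ⟨a, rfl⟩ := hSbij.2 b
    have h2 := congrArg S (hconj a)
    rw [hSmul, hSmul] at h2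
    rw [mul_assoc, ← hconj, ← mul_assoc, h2, mul_assoc]
  have hc' : S z * z = z * S z := by
    have := congrArg (· * w) (hc z)
    simp only [mul_assoc, hzw, mul_one] at this
    exact this
  have hzz : z ^ 2 = S z * z * g := by
    rw [hc', hgz, mul_assoc, ← mul_assoc (S z), hSwz, one_mul, sq]
  have hcc (b : H) : Commute (S z * z) b := hc b
  refine ⟨z, w, hzw, hwz, fun a => ?_, 2 * m, by omega, fun a => ?_⟩
  · rw [← hconj, mul_assoc, hzw, mul_one]
  · rw [pow_mul, hzz, (hcc g).mul_pow, hgm, mul_one]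
    exact (hcc a).pow_left m

end Radford

section TraceFormulas

lemma LinearMap.trace_piMap {k ι : Type*} [Field k] [Fintype ι] [DecidableEq ι] {M : ι → Type*}
    [∀ i, AddCommGroup (M i)] [∀ i, Module k (M i)] [∀ i, FiniteDimensional k (M i)]
    (f : ∀ i, M i →ₗ[k] M i) :
    LinearMap.trace k (∀ i, M i) (LinearMap.piMap f) = ∑ i, LinearMap.trace k (M i) (f i) := by
  classical
  let b := fun i => Module.finBasis k (M i)
  rw [LinearMap.trace_eq_matrix_trace k (Pi.basis b), Matrix.trace, Fintype.sum_sigma]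
  refine Finset.sum_congr rfl fun i _ => ?_
  rw [LinearMap.trace_eq_matrix_trace k (b i), Matrix.trace]
  refine Finset.sum_congr rfl fun j _ => ?_
  simp [LinearMap.toMatrix_apply, Pi.basis_repr]

lemma Matrix.trace_mulLeft_comp_mulRight {k n : Type*} [Field k] [Fintype n] [DecidableEq n]
    (z w : Matrix n n k) :
    LinearMap.trace k (Matrix n n k) (LinearMap.mulLeft k z ∘ₗ LinearMap.mulRight k w) =
      z.trace * w.trace := by
  rw [LinearMap.trace_eq_matrix_trace k (Matrix.stdBasis k n n), Matrix.trace, Matrix.trace,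
    Matrix.trace, Finset.sum_mul_sum, ← Finset.univ_product_univ, Finset.sum_product]
  refine Finset.sum_congr rfl fun i _ => Finset.sum_congr rfl fun j _ => ?_
  rw [Matrix.diag_apply, LinearMap.toMatrix_apply, Matrix.stdBasis_eq_single]
  have h (M : Matrix n n k) : (Matrix.stdBasis k n n).repr M (i, j) = M i j := rfl
  simp [h, Matrix.mul_apply, Matrix.single_apply, ite_and]

lemma LinearMap.trace_piTensorProduct_map {k ι : Type*} [Field k] [Fintype ι] {M : ι → Type*}
    [∀ i, AddCommGroup (M i)] [∀ i, Module k (M i)] [∀ i, FiniteDimensional k (M i)]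
    (f : ∀ i, M i →ₗ[k] M i) :
    LinearMap.trace k (⨂[k] i, M i) (PiTensorProduct.map f) =
      ∏ i, LinearMap.trace k (M i) (f i) := by
  classical
  let b := fun i => Module.finBasis k (M i)
  rw [LinearMap.trace_eq_matrix_trace k (Basis.piTensorProduct b), Matrix.trace]
  have (i : ι) := LinearMap.trace_eq_matrix_trace k (b i) (f i)
  simp only [this, Matrix.trace, Finset.prod_univ_sum, Fintype.piFinset_univ]
  refine Finset.sum_congr rfl fun p _ => ?_
  simp [LinearMap.toMatrix_apply, Basis.piTensorProduct_apply,
    Basis.piTensorProduct_repr_tprod_apply]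

/-- The traces of the powers of an endomorphism of finite order are power sums of roots of unity. -/
lemma Module.End.exists_trace_pow_eq_sum {K V : Type*} [Field K] [IsAlgClosed K] [CharZero K]
    [AddCommGroup V] [Module K V] [FiniteDimensional K V] {f : Module.End K V} {N : ℕ}
    (hN : 0 < N) (hf : f ^ N = 1) :
    ∃ (s : Finset K) (m : K → ℕ), (∀ μ ∈ s, μ ^ N = 1) ∧
      ∀ j, LinearMap.trace K V (f ^ j) = ∑ μ ∈ s, m μ * μ ^ j := by
  classical
  have hss : f.IsSemisimple := by
    refine Module.End.isSemisimple_of_squarefree_aeval_eq_zero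
      (p := Polynomial.X ^ N - 1) ?_ (by simp [hf])
    exact ((Polynomial.X_pow_sub_one_separable_iff).2 (by exact_mod_cast hN.ne')).squarefree
  have hint : DirectSum.IsInternal f.eigenspace :=
    (DirectSum.isInternal_submodule_iff_iSupIndep_and_iSup_eq_top _).2
      ⟨f.eigenspaces_iSupIndep, hss.iSup_eigenspace_eq_top⟩
  have hfin : {μ | f.eigenspace μ ≠ ⊥}.Finite :=
    WellFoundedGT.finite_ne_bot_of_iSupIndep f.eigenspaces_iSupIndep
  have hpow (j : ℕ) (μ : K) (x : V) (hx : x ∈ f.eigenspace μ) : (f ^ j) x = μ ^ j • x := by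
    have hx' : f x = μ • x := Module.End.mem_eigenspace_iff.1 hx
    induction j with
    | zero => simp
    | succ j ih => rw [pow_succ, Module.End.mul_apply, hx', map_smul, ih, smul_smul, pow_succ']
  refine ⟨hfin.toFinset, fun μ => Module.finrank K (f.eigenspace μ), fun μ hμ => ?_, fun j => ?_⟩
  · obtain ⟨x, hx, hx0⟩ := (Submodule.ne_bot_iff _).1 (hfin.mem_toFinset.1 hμ)
    have := hpow N μ x hx
    rw [hf, Module.End.one_apply] at this
    exact smul_left_injective K hx0 (by simp [← this])
  · have hmaps (μ : K) : Set.MapsTo (f ^ j) (f.eigenspace μ) (f.eigenspace μ) := fun x hx => by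
      rw [hpow j μ x hx]
      exact Submodule.smul_mem _ _ hx
    rw [LinearMap.trace_eq_sum_trace_restrict' hint hfin hmaps]
    refine Finset.sum_congr rfl fun μ _ => ?_
    have : (f ^ j).restrict (hmaps μ) = μ ^ j • LinearMap.id := by
      ext x
      exact hpow j μ x x.2
    rw [this, map_smul, LinearMap.trace_id, smul_eq_mul, mul_comm]

end TraceFormulas

section Positivity

variable {K : Type*} [Field K] [IsAlgClosed K] [CharZero K]

/-- `tr z * tr z⁻¹` is a non-negative real algebraic number if `z` is a matrix with a scalar
power. -/
lemma Matrix.exists_trace_mul_trace_eq {n : Type*} [Fintype n] [DecidableEq n]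
    (φ : algebraicClosure ℚ K →+* ℂ) {z w : Matrix n n K} (hzw : z * w = 1) {N : ℕ} (hN : 0 < N)
    {c : K} (hc : z ^ N = Matrix.scalar n c) :
    ∃ q : algebraicClosure ℚ K, (q : K) = z.trace * w.trace ∧ 0 ≤ (φ q).re := by
  rcases isEmpty_or_nonempty n with _ | ⟨⟨i⟩⟩
  · exact ⟨0, by simp⟩
  obtain ⟨s, hs⟩ := IsAlgClosed.exists_pow_nat_eq c hN
  have : Nonempty n := ⟨i⟩
  have hc0 : c ≠ 0 := by
    rintro rfl
    have h1 := (IsUnit.of_mul_eq_one w hzw).pow N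
    rw [hc, map_zero] at h1
    exact not_isUnit_zero h1
  have hs0 : s ≠ 0 := by
    rintro rfl
    exact hc0 (by rw [← hs, zero_pow hN.ne'])
  let y := s⁻¹ • z
  have hy : y ^ N = 1 := by
    rw [smul_pow, hc, inv_pow, hs]
    ext a b
    simp [Matrix.scalar_apply, Matrix.diagonal_apply, Matrix.one_apply, hc0]
  have hyw : y ^ (N - 1) = s • w := by
    have h1 : y * (s • w) = 1 := by simp [y, hzw, smul_smul, hs0]
    calc y ^ (N - 1) = y ^ (N - 1) * (y * (s • w)) := by rw [h1, mul_one]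
      _ = s • w := by rw [← mul_assoc, ← pow_succ, Nat.sub_add_cancel hN, hy, one_mul]
  obtain ⟨t, m, ht, htr⟩ := Module.End.exists_trace_pow_eq_sum (f := Matrix.toLin' y) hN
    (by rw [← Matrix.toLin'_pow, hy, Matrix.toLin'_one]; rfl)
  have htr' (j : ℕ) : (y ^ j).trace = ∑ μ ∈ t, m μ * μ ^ j := by
    rw [← htr, ← Matrix.toLin'_pow, Matrix.trace_toLin'_eq]
  have hprod : z.trace * w.trace = (y ^ 1).trace * (y ^ (N - 1)).trace := by
    rw [hyw, pow_one, Matrix.trace_smul, Matrix.trace_smul, smul_eq_mul, smul_eq_mul]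
    field_simp
  have hμ (μ : t) : ∃ q : algebraicClosure ℚ K, (q : K) = μ ∧ q ^ N = 1 := by
    refine ⟨⟨μ, mem_algebraicClosure_iff.2 ?_⟩, rfl, Subtype.ext (by simp [ht μ μ.2])⟩
    exact (IsIntegral.of_pow hN (by rw [ht μ μ.2]; exact isIntegral_one)).isAlgebraic
  choose q hq hqN using hμ
  refine ⟨(∑ μ : t, m μ * q μ) * ∑ μ : t, m μ * q μ ^ (N - 1), ?_, ?_⟩
  · rw [hprod, htr', htr', ← Finset.sum_coe_sort t, ← Finset.sum_coe_sort t]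
    simp [hq]
  · have hconj (μ : t) : φ (q μ) ^ (N - 1) = star (φ (q μ)) := by
      have h1 : φ (q μ) ^ N = 1 := by rw [← map_pow, hqN, map_one]
      have h2 : ‖φ (q μ)‖ = 1 := Complex.norm_eq_one_of_pow_eq_one h1 hN.ne'
      have h3 : φ (q μ) ≠ 0 := by rintro h; simp [h] at h2
      have h4 : φ (q μ) * star (φ (q μ)) = 1 := by
        simpa [h2] using Complex.mul_conj' (φ (q μ))
      apply mul_left_cancel₀ h3
      rw [h4, ← pow_succ', Nat.sub_add_cancel hN, h1]
    have : φ ((∑ μ : t, m μ * q μ) * ∑ μ : t, m μ * q μ ^ (N - 1)) =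
        (∑ μ : t, (m μ : ℂ) * φ (q μ)) * star (∑ μ : t, (m μ : ℂ) * φ (q μ)) := by
      simp [hconj]
    rw [this]
    have h5 := Complex.mul_conj (∑ μ : t, (m μ : ℂ) * φ (q μ))
    rw [Complex.star_def, h5, Complex.ofReal_re]
    exact Complex.normSq_nonneg _

end Positivity

section LarsonRadford

lemma trace_antipodeSq_ne_zero_of_isAlgClosed (K H : Type*) [Field K] [IsAlgClosed K] [CharZero K]
    [Ring H] [HopfAlgebra K H] [FiniteDimensional K H] [IsSemisimpleRing H] :
    LinearMap.trace K H (antipodeSq K H) ≠ 0 := by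
  obtain ⟨z, w, hzw, hwz, hconj, N, hN, hcomm⟩ := exists_antipode_antipode_eq_conj (k := K) (H := H)
  obtain ⟨Λ, hl, hr, hΛ⟩ := exists_integral (k := K) (H := H)
  obtain ⟨n, d, hd, ⟨e⟩⟩ := IsSemisimpleRing.exists_algEquiv_pi_matrix_of_isAlgClosed K H
  have htrace : LinearMap.trace K H (antipodeSq K H) = ∑ i, (e z i).trace * (e w i).trace := by
    have h1 : e.toLinearEquiv.conj (antipodeSq K H) = LinearMap.piMap fun i =>
        LinearMap.mulLeft K (e z i) ∘ₗ LinearMap.mulRight K (e w i) := by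
      refine LinearMap.ext fun x => funext fun i => ?_
      simp [LinearEquiv.conj_apply, antipodeSq, hconj, mul_assoc]
    rw [← LinearMap.trace_conj' _ e.toLinearEquiv, h1, LinearMap.trace_piMap]
    simp only [Matrix.trace_mulLeft_comp_mulRight]
  have hscalar {a : H} (ha : ∀ b, Commute a b) (i : Fin n) :
      ∃ c : K, e a i = Matrix.scalar (Fin (d i)) c := by
    have : e a i ∈ Set.range (Matrix.scalar (Fin (d i))) := by
      refine Matrix.mem_range_scalar_iff_commute_single'.2 fun p q => ?_
      have := congrArg (fun f => e f i) (ha (e.symm (Pi.single i (Matrix.single p q 1)))).eq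
      simp only [map_mul, Pi.mul_apply, AlgEquiv.apply_symm_apply, Pi.single_eq_same] at this
      exact this.symm
    obtain ⟨c, hc⟩ := this
    exact ⟨c, hc.symm⟩
  have : Algebra.IsAlgebraic ℚ (algebraicClosure ℚ K) := by
    convert! algebraicClosure.isAlgebraic ℚ K
  let φ : algebraicClosure ℚ K →+* ℂ :=
    (IsAlgClosed.lift (R := ℚ) (S := algebraicClosure ℚ K) (M := ℂ)).toRingHom
  have hzw' (i : Fin n) : e z i * e w i = 1 := by
    rw [← Pi.mul_apply, ← map_mul, hzw, map_one, Pi.one_apply]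
  have hex (i : Fin n) : ∃ q : algebraicClosure ℚ K,
      (q : K) = (e z i).trace * (e w i).trace ∧ 0 ≤ (φ q).re := by
    obtain ⟨c, hc⟩ := hscalar hcomm i
    exact Matrix.exists_trace_mul_trace_eq φ (hzw' i) hN (by simpa using hc)
  choose q hq hqre using hex
  obtain ⟨i, hi⟩ : ∃ i, e Λ i ≠ 0 := by
    by_contra! h
    have : Λ = 0 := e.injective (by rw [map_zero]; exact funext h)
    rw [this, map_zero] at hΛ
    exact zero_ne_one hΛ
  obtain ⟨c, hc⟩ := hscalar (a := Λ) (fun b => (hr b).trans (hl b).symm) i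
  have hc0 : c ≠ 0 := by
    rintro rfl
    exact hi (by rw [hc, map_zero])
  have hblock (a : H) : e a i = Matrix.scalar (Fin (d i)) (counit (R := K) a) := by
    have h1 := congrArg (fun f => e f i) (hl a)
    simp only [map_mul, map_smul, Pi.mul_apply, Pi.smul_apply, hc] at h1
    ext p r
    have h2 := congrFun (congrFun h1 p) r
    simp only [Matrix.scalar_apply, Matrix.smul_apply,
      Matrix.mul_diagonal, Matrix.diagonal_apply, smul_eq_mul] at h2 ⊢
    apply mul_right_cancel₀ hc0
    simpa using h2
  have hqi : q i = (d i : algebraicClosure ℚ K) ^ 2 := by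
    apply Subtype.ext
    have h3 : counit (R := K) z * counit (R := K) w = 1 := by
      rw [← Bialgebra.counit_mul, hzw, Bialgebra.counit_one]
    rw [hq, hblock, hblock]
    simp only [Matrix.scalar_apply, Matrix.trace_diagonal, Finset.sum_const, Finset.card_univ,
      Fintype.card_fin, nsmul_eq_mul]
    push_cast
    linear_combination (d i : K) ^ 2 * h3
  intro h0
  have hsum : ∑ i, q i = 0 := by
    apply Subtype.ext
    rw [htrace] at h0
    simpa [hq] using h0
  have hre := congrArg (fun x => (φ x).re) hsum
  simp only [map_sum, map_zero, Complex.re_sum, Complex.zero_re] at hre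
  have h4 := (Finset.sum_eq_zero_iff_of_nonneg fun i _ => hqre i).1 hre i (Finset.mem_univ i)
  rw [hqi, map_pow, map_natCast, ← Nat.cast_pow, Complex.natCast_re] at h4
  exact (hd i).out (by simpa using h4)

lemma IsLeftIntegral.one_tmul {k H : Type*} [Field k] [Ring H] [HopfAlgebra k H] (K : Type*)
    [Field K] [Algebra k K] {Λ : H} (hΛ : IsLeftIntegral k Λ) :
    IsLeftIntegral K ((1 : K) ⊗ₜ[k] Λ) := by
  intro a
  induction a with
  | zero => simp
  | add x y hx hy => rw [add_mul, hx, hy, map_add, add_smul]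
  | tmul x y =>
    rw [Algebra.TensorProduct.tmul_mul_tmul, hΛ y, TensorProduct.tmul_smul]
    simp [TensorProduct.smul_tmul']

/-- The **Larson–Radford theorem**: a finite-dimensional Hopf algebra over a field of characteristic
zero is semisimple if and only if the square of its antipode has non-zero trace. -/
theorem isSemisimpleRing_iff_trace_antipodeSq_ne_zero (k H : Type*) [Field k] [CharZero k] [Ring H]
    [HopfAlgebra k H] [FiniteDimensional k H] :
    IsSemisimpleRing H ↔ LinearMap.trace k H (antipodeSq k H) ≠ 0 := by
  refine ⟨fun _ => ?_, isSemisimpleRing_of_trace_ne_zero⟩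
  let K := AlgebraicClosure k
  have : CharZero K := charZero_of_injective_algebraMap (algebraMap k K).injective
  obtain ⟨Λ, hl, -, hΛ⟩ := exists_integral (k := k) (H := H)
  have : IsSemisimpleRing (K ⊗[k] H) :=
    isSemisimpleRing_of_isLeftIntegral (hl.one_tmul K) (by simp [hΛ])
  have h := trace_antipodeSq_ne_zero_of_isAlgClosed K (K ⊗[k] H)
  have hS : antipodeSq K (K ⊗[k] H) = (antipodeSq k H).baseChange K := by
    ext x
    simp [antipodeSq, TensorProduct.antipode_def]
  rw [hS, LinearMap.trace_baseChange] at h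
  exact fun h0 => h (by rw [h0, map_zero])

end LarsonRadford

/-- Suppose a finite-dimensional Hopf algebra `H` over a field of characteristic `0` is
isomorphic (as a Hopf algebra) to an iterated double cross product of Hopf algebras
`A₁, …, Aₙ`, with `S_H²` corresponding to `S_{A₁}² ⊗ ⋯ ⊗ S_{Aₙ}²`.  Then `H` is
semisimple if and only if every `Aᵢ` is semisimple. -/
theorem semisimple_iff_factors_semisimple (k : Type*) [Field k] [CharZero k] (n : ℕ)
    (A : Fin n → Type*) [∀ i, Ring (A i)] [∀ i, HopfAlgebra k (A i)]
    [∀ i, FiniteDimensional k (A i)]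
    (H : Type*) [Ring H] [HopfAlgebra k H] [FiniteDimensional k H]
    (f : (⨂[k] i, A i) ≃ₗ[k] H)
    (hS : ∀ x : ⨂[k] i, A i,
      HopfAlgebra.antipode (R := k) (HopfAlgebra.antipode (R := k) (f x)) =
        f (PiTensorProduct.map
          (fun i => HopfAlgebra.antipode (R := k) (A := A i) ∘ₗ
            HopfAlgebra.antipode (R := k) (A := A i)) x)) :
    IsSemisimpleRing H ↔ ∀ i, IsSemisimpleRing (A i) := by
  have h : antipodeSq k H = f.conj (PiTensorProduct.map fun i => antipodeSq k (A i)) := by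
    refine LinearMap.ext fun y => ?_
    obtain ⟨x, rfl⟩ := f.surjective y
    simpa [antipodeSq, LinearEquiv.conj_apply] using hS x
  simp only [isSemisimpleRing_iff_trace_antipodeSq_ne_zero k, h, LinearMap.trace_conj',
    LinearMap.trace_piTensorProduct_map, Finset.prod_ne_zero_iff, Finset.mem_univ, true_imp_iff]
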